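/- arXiv:0706.0474 — 2 statements merged into one kernel-verified Lean document; each statement's English description precedes it below -/
import Mathlib

section
/- Let (Ω, F, P) be a probability space and let (f^k)_{k∈ℕ} be a sequence of nonnegative integrable random variables and f^0 a nonnegative integrable random variable such that E[f^k] → E[f^0] as k → ∞ and liminf_{k→∞} f^k = f^0 P-almost surely. Then there exists a subsequence (f^{k_l})_{l∈ℕ} which converges to f^0 P-almost surely. -/
open Filter Topology MeasureTheory

/-- If `b` lies below the real `liminf` of a sequence bounded below, then the sequence eventually
exceeds `b`; no upper bound on the sequence is needed. -/
lemma eventually_lt_of_lt_liminf_of_bddBelow {u : ℕ → ℝ} {c b : ℝ} (hu : ∀ n, c ≤ u n)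
    (hb : b < liminf u atTop) : ∀ᶠ n in atTop, b < u n := by
  rw [liminf_eq] at hb
  obtain ⟨a, ha, hba⟩ : ∃ a ∈ {a | ∀ᶠ n in atTop, a ≤ u n}, b < a := by
    by_cases hbdd : BddAbove {a | ∀ᶠ n in atTop, a ≤ u n}
    · exact exists_lt_of_lt_csSup ⟨c, Eventually.of_forall hu⟩ hb
    · exact not_bddAbove_iff.mp hbdd b
  exact ha.mono fun n hn => hba.trans_le hn

lemma tendsto_min_liminf_of_bddBelow {u : ℕ → ℝ} {c : ℝ} (hu : ∀ n, c ≤ u n) :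
    Tendsto (fun n => min (u n) (liminf u atTop)) atTop (𝓝 (liminf u atTop)) := by
  refine tendsto_order.2 ⟨fun b hb => ?_, fun b hb => ?_⟩
  · filter_upwards [eventually_lt_of_lt_liminf_of_bddBelow hu hb] with n hn
    exact lt_min hn hb
  · exact Eventually.of_forall fun n => (min_le_right _ _).trans_lt hb

/-- Lemma A.2 ("inverse Fatou"): if nonnegative integrable `f^k` satisfy
`E[f^k] → E[f^0]` and `liminf_k f^k = f^0` a.s., then some subsequence of `f^k`
converges to `f^0` almost surely. -/
theorem stmt1 {Ω : Type*} [MeasurableSpace Ω] (P : Measure Ω) [IsProbabilityMeasure P]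
    (f : ℕ → Ω → ℝ) (f0 : Ω → ℝ)
    (hf_nonneg : ∀ k ω, 0 ≤ f k ω) (hf0_nonneg : ∀ ω, 0 ≤ f0 ω)
    (hf_int : ∀ k, Integrable (f k) P) (hf0_int : Integrable f0 P)
    (hE : Tendsto (fun k => ∫ ω, f k ω ∂P) atTop (𝓝 (∫ ω, f0 ω ∂P)))
    (hliminf : ∀ᵐ ω ∂P, Filter.liminf (fun k => f k ω) atTop = f0 ω) :
    ∃ φ : ℕ → ℕ, StrictMono φ ∧
      ∀ᵐ ω ∂P, Tendsto (fun l => f (φ l) ω) atTop (𝓝 (f0 ω)) := by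
  have hmin_int (k : ℕ) : Integrable (fun ω => min (f k ω) (f0 ω)) P := (hf_int k).inf hf0_int
  have hmin : Tendsto (fun k => ∫ ω, min (f k ω) (f0 ω) ∂P) atTop (𝓝 (∫ ω, f0 ω ∂P)) := by
    refine tendsto_integral_of_dominated_convergence f0
      (fun k => (hmin_int k).aestronglyMeasurable) hf0_int (fun k => ?_) ?_
    · refine Eventually.of_forall fun ω => ?_
      rw [Real.norm_of_nonneg (le_min (hf_nonneg k ω) (hf0_nonneg ω))]
      exact min_le_right _ _
    · filter_upwards [hliminf] with ω hω
      simpa only [hω] using tendsto_min_liminf_of_bddBelow fun k => hf_nonneg k ω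
  have hnorm_eq (k : ℕ) : ∫ ω, ‖(f k - f0) ω‖ ∂P =
      ∫ ω, f k ω ∂P + ∫ ω, f0 ω ∂P - 2 * ∫ ω, min (f k ω) (f0 ω) ∂P := by
    rw [← integral_add (hf_int k) hf0_int, ← integral_const_mul,
      ← integral_sub ((hf_int k).fun_add hf0_int) ((hmin_int k).const_mul 2)]
    refine integral_congr_ae (Eventually.of_forall fun ω => ?_)
    simp only [Pi.sub_apply, Real.norm_eq_abs]
    rcases le_total (f k ω) (f0 ω) with h | h
    · rw [min_eq_left h, abs_of_nonpos (sub_nonpos.2 h)]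
      ring
    · rw [min_eq_right h, abs_of_nonneg (sub_nonneg.2 h)]
      ring
  have hnorm : Tendsto (fun k => ∫ ω, ‖(f k - f0) ω‖ ∂P) atTop (𝓝 0) := by
    simp only [hnorm_eq]
    convert (hE.add_const (∫ ω, f0 ω ∂P)).sub (hmin.const_mul 2) using 2
    ring
  have hLp : Tendsto (fun k => eLpNorm (f k - f0) 1 P) atTop (𝓝 0) := by
    simp only [eLpNorm_one_eq_lintegral_enorm,
      ← ofReal_integral_norm_eq_lintegral_enorm ((hf_int _).sub hf0_int)]
    simpa using ENNReal.tendsto_ofReal hnorm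
  exact (tendstoInMeasure_of_tendsto_eLpNorm one_ne_zero
    (fun k => (hf_int k).aestronglyMeasurable) hf0_int.aestronglyMeasurable
    hLp).exists_seq_tendsto_ae
end

section
/- Let γ be the standard Gaussian measure on ℝ with cumulative distribution function Φ. For each integer n ≥ 2 let α_n and β_n be real numbers with Φ(α_n) = 1 − n⁻⁵/2 and Φ(β_n) = n⁻³/2 (so β_n < α_n), and define f^n : ℝ → ℝ by f^n(x) = n if x ≥ α_n, f^n(x) = 1 if β_n < x < α_n, and f^n(x) = 1/n if x ≤ β_n. Then: (i) f^n → 1 γ-almost everywhere; (ii) ∫ f^n dγ = 1 + n⁻⁴ − n⁻⁵/2 − n⁻³/2 → 1; and (iii) ∫ (f^n)⁻³ dγ → 3/2. -/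
open Filter Topology MeasureTheory ProbabilityTheory Set
open scoped ENNReal

/-- The integral of a three-valued step function against an atomless probability measure. -/
theorem integral_step_of_lt (μ : Measure ℝ) [IsProbabilityMeasure μ] [NullSingletonClass μ]
    {a b : ℝ} (hab : b < a) (p q : ℝ) :
    ∫ x, (if a ≤ x then p else if x ≤ b then q else 1) ∂μ =
      1 + (p - 1) * (1 - μ.real (Iic a)) + (q - 1) * μ.real (Iic b) := by
  have hIci : μ.real (Ici a) = 1 - μ.real (Iic a) := by
    rw [← probReal_compl_eq_one_sub measurableSet_Iic, compl_Iic]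
    exact measureReal_congr Ioi_ae_eq_Ici.symm
  have hstep : ∀ x : ℝ, (if a ≤ x then p else if x ≤ b then q else 1) =
      1 + (Ici a).indicator (fun _ => p - 1) x + (Iic b).indicator (fun _ => q - 1) x := by
    intro x
    simp only [indicator_apply, mem_Ici, mem_Iic]
    split_ifs <;> linarith
  have hp : Integrable ((Ici a).indicator fun _ : ℝ => p - 1) μ :=
    (integrable_const _).indicator measurableSet_Ici
  have hq : Integrable ((Iic b).indicator fun _ : ℝ => q - 1) μ :=
    (integrable_const _).indicator measurableSet_Iic
  have h1p : Integrable (fun x => 1 + (Ici a).indicator (fun _ : ℝ => p - 1) x) μ :=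
    (integrable_const _).add hp
  simp_rw [hstep]
  rw [integral_add h1p hq, integral_add (integrable_const _) hp,
    integral_indicator_const _ measurableSet_Ici, integral_indicator_const _ measurableSet_Iic,
    hIci]
  simp only [integral_const, probReal_univ, smul_eq_mul]
  ring

theorem gaussianReal_real_pos_of_isOpen {m : ℝ} {v : NNReal} (hv : v ≠ 0) {s : Set ℝ}
    (hs : IsOpen s) (hne : s.Nonempty) : 0 < (gaussianReal m v).real s := by
  refine ENNReal.toReal_pos (fun h => ?_) (measure_ne_top _ _)
  exact (hs.measure_pos volume hne).ne' (gaussianReal_absolutelyContinuous' m hv h)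

theorem tendsto_natCast_zpow_neg_atTop {k : ℤ} (hk : k < 0) :
    Tendsto (fun n : ℕ => (n : ℝ) ^ k) atTop (𝓝 0) :=
  (tendsto_zpow_atTop_zero hk).comp tendsto_natCast_atTop_atTop

/-- The core computation in Example 2.11: with `γ` the standard Gaussian measure
on `ℝ` with cdf `Φ`, `Φ(α_n) = 1 - n⁻⁵/2`, `Φ(β_n) = n⁻³/2`, and
`f^n = n·1_{[α_n,∞)} + 1_{(β_n,α_n)} + n⁻¹·1_{(-∞,β_n]}`, we have
(i) `f^n → 1` `γ`-a.e.; (ii) `∫ f^n dγ = 1 + n⁻⁴ - n⁻⁵/2 - n⁻³/2 → 1`;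
(iii) `∫ (f^n)⁻³ dγ → 3/2`. -/
theorem stmt7 (γ : Measure ℝ) (hγ : γ = gaussianReal 0 1)
    (Φ : ℝ → ℝ) (hΦ : ∀ x, Φ x = (γ (Iic x)).toReal)
    (α β : ℕ → ℝ)
    (hα : ∀ n, 2 ≤ n → Φ (α n) = 1 - (n : ℝ) ^ (-5 : ℤ) / 2)
    (hβ : ∀ n, 2 ≤ n → Φ (β n) = (n : ℝ) ^ (-3 : ℤ) / 2)
    (f : ℕ → ℝ → ℝ)
    (hf : ∀ n x, f n x =
      if α n ≤ x then (n : ℝ) else if x ≤ β n then (n : ℝ)⁻¹ else 1) :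
    (∀ᵐ x ∂γ, Tendsto (fun n => f n x) atTop (𝓝 1)) ∧
      (∀ n, 2 ≤ n → ∫ x, f n x ∂γ =
        1 + (n : ℝ) ^ (-4 : ℤ) - (n : ℝ) ^ (-5 : ℤ) / 2 - (n : ℝ) ^ (-3 : ℤ) / 2) ∧
      Tendsto (fun n => ∫ x, f n x ∂γ) atTop (𝓝 1) ∧
      Tendsto (fun n => ∫ x, (f n x) ^ (-3 : ℤ) ∂γ) atTop (𝓝 (3 / 2)) := by
  subst hγ
  have : NullSingletonClass (gaussianReal 0 1) := nullSingletonClass_gaussianReal one_ne_zero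
  have hΦr : ∀ x, (gaussianReal 0 1).real (Iic x) = Φ x := fun x => (hΦ x).symm
  have hmono : Monotone Φ := fun x y hxy => by
    rw [← hΦr, ← hΦr]
    exact measureReal_mono (Iic_subset_Iic.2 hxy)
  have hpos : ∀ x, 0 < Φ x := fun x => by
    rw [← hΦr]
    exact (gaussianReal_real_pos_of_isOpen one_ne_zero isOpen_Iio nonempty_Iio).trans_le
      (measureReal_mono Iio_subset_Iic_self)
  have hlt_one : ∀ x, Φ x < 1 := fun x => by
    have h := gaussianReal_real_pos_of_isOpen (m := 0) one_ne_zero isOpen_Ioi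
      (nonempty_Ioi (a := x))
    rw [← compl_Iic, probReal_compl_eq_one_sub measurableSet_Iic, hΦr] at h
    linarith
  have h3 := tendsto_natCast_zpow_neg_atTop (k := -3) (by norm_num)
  have h4 := tendsto_natCast_zpow_neg_atTop (k := -4) (by norm_num)
  have h5 := tendsto_natCast_zpow_neg_atTop (k := -5) (by norm_num)
  have h8 := tendsto_natCast_zpow_neg_atTop (k := -8) (by norm_num)
  have hβα : ∀ n, 2 ≤ n → β n < α n := fun n hn => by
    refine hmono.reflect_lt ?_
    rw [hα n hn, hβ n hn]
    have hn1 : (1 : ℝ) < n := by exact_mod_cast hn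
    have e3 : (n : ℝ) ^ (-3 : ℤ) < 1 := zpow_lt_one_of_neg₀ hn1 (by norm_num)
    have e5 : (n : ℝ) ^ (-5 : ℤ) < 1 := zpow_lt_one_of_neg₀ hn1 (by norm_num)
    linarith
  have hint : ∀ n, 2 ≤ n → ∫ x, f n x ∂(gaussianReal 0 1) =
      1 + (n : ℝ) ^ (-4 : ℤ) - (n : ℝ) ^ (-5 : ℤ) / 2 - (n : ℝ) ^ (-3 : ℤ) / 2 := fun n hn => by
    have hn0 : (n : ℝ) ≠ 0 := by positivity
    simp_rw [hf]
    rw [integral_step_of_lt _ (hβα n hn), hΦr, hΦr, hα n hn, hβ n hn]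
    field_simp
    ring
  have hint3 : ∀ n, 2 ≤ n → ∫ x, (f n x) ^ (-3 : ℤ) ∂(gaussianReal 0 1) =
      3 / 2 + (n : ℝ) ^ (-8 : ℤ) / 2 - (n : ℝ) ^ (-5 : ℤ) / 2 - (n : ℝ) ^ (-3 : ℤ) / 2 :=
    fun n hn => by
    have hn0 : (n : ℝ) ≠ 0 := by positivity
    have hpow : ∀ x, (f n x) ^ (-3 : ℤ) = if α n ≤ x then (n : ℝ) ^ (-3 : ℤ)
        else if x ≤ β n then ((n : ℝ)⁻¹) ^ (-3 : ℤ) else 1 := fun x => by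
      rw [hf]
      split_ifs <;> simp
    simp_rw [hpow]
    rw [integral_step_of_lt _ (hβα n hn), hΦr, hΦr, hα n hn, hβ n hn]
    field_simp
    ring
  refine ⟨ae_of_all _ fun x => ?_, hint, ?_, ?_⟩
  · refine tendsto_const_nhds.congr' ?_
    have hx3 : ∀ᶠ n : ℕ in atTop, (n : ℝ) ^ (-3 : ℤ) < Φ x := h3.eventually_lt_const (hpos x)
    have hx5 : ∀ᶠ n : ℕ in atTop, (n : ℝ) ^ (-5 : ℤ) < 1 - Φ x :=
      h5.eventually_lt_const (sub_pos.2 (hlt_one x))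
    filter_upwards [hx3, hx5, eventually_ge_atTop 2] with n hn3 hn5 hn
    have hxα : x < α n := hmono.reflect_lt (by rw [hα n hn]; linarith [hlt_one x])
    have hxβ : β n < x := hmono.reflect_lt (by rw [hβ n hn]; linarith [hpos x])
    rw [hf, if_neg hxα.not_ge, if_neg hxβ.not_ge]
  · have h := ((h4.const_add 1).sub (h5.div_const 2)).sub (h3.div_const 2)
    norm_num only at h
    refine h.congr' ?_
    filter_upwards [eventually_ge_atTop 2] with n hn using (hint n hn).symm
  · have h := (((h8.div_const 2).const_add (3 / 2)).sub (h5.div_const 2)).sub (h3.div_const 2)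
    norm_num only at h
    refine h.congr' ?_
    filter_upwards [eventually_ge_atTop 2] with n hn using (hint3 n hn).symm
end
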